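/- Locality of interval-linearizability: An execution E is interval-linearizable if and only if, for every object X, the projection E|_X (the subsequence of events of E on object X) is interval-linearizable with respect to X alone. -/

import Mathlib

/-! ## Executions over multiple objects, interval-sequential objects,
interval-linearizability -/

/-- An event: an invocation by a process of an operation of an object with an input
value, or a response to a process from an operation of an object with an output
value. -/
inductive GEv (Proc Obj Op In Out : Type) where
  | inv (p : Proc) (X : Obj) (o : Op) (x : In)
  | res (p : Proc) (X : Obj) (o : Op) (y : Out)
deriving DecidableEq

namespace GEv

variable {Proc Obj Op In Out : Type}

/-- The process of the event. -/
def proc : GEv Proc Obj Op In Out → Proc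
  | .inv p _ _ _ => p
  | .res p _ _ _ => p

/-- The object of the event. -/
def obj : GEv Proc Obj Op In Out → Obj
  | .inv _ X _ _ => X
  | .res _ X _ _ => X

/-- Is the event an invocation? -/
def isInv : GEv Proc Obj Op In Out → Bool
  | .inv _ _ _ _ => true
  | _ => false

/-- Is the event a response? -/
def isRes : GEv Proc Obj Op In Out → Bool
  | .res _ _ _ _ => true
  | _ => false

end GEv

variable {Proc Obj Op In Out : Type} [DecidableEq Proc] [DecidableEq Obj]
  [DecidableEq Op] [DecidableEq In] [DecidableEq Out]

/-- Projection of an execution onto a process. -/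
def projP (E : List (GEv Proc Obj Op In Out)) (p : Proc) :
    List (GEv Proc Obj Op In Out) :=
  E.filter (fun e => decide (e.proc = p))

/-- Projection of an execution onto an object. -/
def projObj (E : List (GEv Proc Obj Op In Out)) (X : Obj) :
    List (GEv Proc Obj Op In Out) :=
  E.filter (fun e => decide (e.obj = X))

/-- A single process's subsequence alternates invocations and matching responses,
beginning with an invocation. -/
def procAlt : List (GEv Proc Obj Op In Out) → Prop
  | [] => True
  | [GEv.inv _ _ _ _] => True
  | GEv.inv _ X o _ :: GEv.res _ X' o' _ :: rest => X = X' ∧ o = o' ∧ procAlt rest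
  | _ => False

/-- A well-formed execution. -/
def WF (E : List (GEv Proc Obj Op In Out)) : Prop :=
  ∀ p : Proc, procAlt (projP E p)

/-- `comp E`: the execution `E` with its pending invocations removed (in a
well-formed execution, an invocation is pending iff no later event is by the
same process). -/
def comp (E : List (GEv Proc Obj Op In Out)) : List (GEv Proc Obj Op In Out) :=
  (List.range E.length).filterMap (fun i =>
    (E[i]?).bind (fun e =>
      if e.isInv && (E.drop (i+1)).all (fun e' => !decide (e'.proc = e.proc))
      then none else some e))

/-- `Ebar` extends `E` by appending zero or more matching responses to pending
invocations (well-formedness of `Ebar` forces the appended responses to match). -/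
def Extension (E Ebar : List (GEv Proc Obj Op In Out)) : Prop :=
  WF Ebar ∧ ∃ F, Ebar = E ++ F ∧ ∀ e ∈ F, e.isRes = true

/-- Position `i` of `E` holds the `m`-th event (0-indexed) of process `p`. -/
def nthEvPos (E : List (GEv Proc Obj Op In Out)) (p : Proc) (m i : ℕ) : Prop :=
  (∃ e, E[i]? = some e ∧ GEv.proc e = p) ∧
  ((E.take i).filter (fun e => decide (e.proc = p))).length = m

/-- The `k`-th operation call of process `p` precedes the `l`-th operation call of
process `q` in real time in `E`: the response of the former (the `(2k+1)`-th event of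
`p`) occurs before the invocation of the latter (the `2l`-th event of `q`). -/
def OpPrec (E : List (GEv Proc Obj Op In Out)) (p : Proc) (k : ℕ) (q : Proc)
    (l : ℕ) : Prop :=
  ∃ i j : ℕ, nthEvPos E p (2*k+1) i ∧ nthEvPos E q (2*l) j ∧ i < j

/-- An invoking concurrency class: a nonempty finite set of invocations, at most one
per process. -/
def InvClass (C : Finset (GEv Proc Obj Op In Out)) : Prop :=
  C.Nonempty ∧ (∀ e ∈ C, e.isInv = true) ∧
    ∀ e ∈ C, ∀ e' ∈ C, e.proc = e'.proc → e = e'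

/-- A responding concurrency class: a nonempty finite set of responses, at most one
per process. -/
def ResClass (C : Finset (GEv Proc Obj Op In Out)) : Prop :=
  C.Nonempty ∧ (∀ e ∈ C, e.isRes = true) ∧
    ∀ e ∈ C, ∀ e' ∈ C, e.proc = e'.proc → e = e'

/-- An interval-sequential execution `I₀,R₀,I₁,R₁,…,I_m,R_m`, represented as a flat
list of concurrency classes: classes at even positions are invoking, classes at odd
positions are responding, and every response matches an earlier invocation with no
further invocation by the same process in between. -/
def IsISExec (h : List (Finset (GEv Proc Obj Op In Out))) : Prop :=
  h.length % 2 = 0 ∧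
  (∀ k C, h[k]? = some C → if k % 2 = 0 then InvClass C else ResClass C) ∧
  (∀ i C r, h[i]? = some C → i % 2 = 1 → r ∈ C →
    ∃ j, j ≤ i ∧ j % 2 = 0 ∧
      (∃ D, h[j]? = some D ∧ ∃ e ∈ D, e.isInv = true ∧ e.proc = r.proc) ∧
      ∀ j' D', j < j' → j' ≤ i → j' % 2 = 0 → h[j']? = some D' →
        ∀ e ∈ D', e.isInv = true → e.proc ≠ r.proc)

/-- An interval-sequential object: a Mealy automaton whose transitions, from a state
and a (nonempty) invoking concurrency class, produce a (nonempty) responding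
concurrency class and a next state; the response uniquely determines the new state. -/
structure GISObject (Proc Obj Op In Out : Type) where
  State : Type
  init : Set State
  δ : State → Finset (GEv Proc Obj Op In Out) →
        Set (Finset (GEv Proc Obj Op In Out) × State)
  valid : ∀ q I R q', (R, q') ∈ δ q I → InvClass I ∧ ResClass R
  det : ∀ q I R q1 q2, (R, q1) ∈ δ q I → (R, q2) ∈ δ q I → q1 = q2

/-- The interval-sequential specification of an object: all interval-sequential
executions generated from an initial state by the transition relation. -/
def GISS (O : GISObject Proc Obj Op In Out) :
    Set (List (Finset (GEv Proc Obj Op In Out))) :=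
  { h | IsISExec h ∧ ∃ q : ℕ → O.State, q 0 ∈ O.init ∧
      ∀ i I R, h[2*i]? = some I → h[2*i+1]? = some R →
        (R, q (i+1)) ∈ O.δ (q i) I }

/-- Projection of an interval-sequential execution onto a process `p`
(each class contains at most one event of `p`). -/
noncomputable def projPIS (h : List (Finset (GEv Proc Obj Op In Out))) (p : Proc) :
    List (GEv Proc Obj Op In Out) :=
  h.flatMap (fun C => (C.filter (fun e => e.proc = p)).toList)

/-- Projection of an interval-sequential execution onto an object `X`: each class is
replaced by its subset of events on `X`, and emptied classes are discarded. -/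
def projObjIS (h : List (Finset (GEv Proc Obj Op In Out))) (X : Obj) :
    List (Finset (GEv Proc Obj Op In Out)) :=
  (h.map (fun C => C.filter (fun e => e.obj = X))).filter
    (fun C => decide C.Nonempty)

/-- The class at position `k` of `h` contains the `m`-th event (0-indexed) of
process `p`. -/
def evInClassAt (h : List (Finset (GEv Proc Obj Op In Out))) (p : Proc)
    (m k : ℕ) : Prop :=
  (∃ C, h[k]? = some C ∧ ∃ e ∈ C, GEv.proc e = p) ∧
  ((h.take k).filter
      (fun C => decide (C.filter (fun e => e.proc = p)).Nonempty)).length = m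

/-- The interval-sequential execution `h` respects the real-time order of `Ecomp`:
whenever an operation call precedes another, every class containing an event of the
first comes before every class containing an event of the second. -/
def Respects (Ecomp : List (GEv Proc Obj Op In Out))
    (h : List (Finset (GEv Proc Obj Op In Out))) : Prop :=
  ∀ (p : Proc) (k : ℕ) (q : Proc) (l : ℕ), OpPrec Ecomp p k q l →
    ∀ m m' a b : ℕ, (m = 2*k ∨ m = 2*k+1) → (m' = 2*l ∨ m' = 2*l+1) →
      evInClassAt h p m a → evInClassAt h q m' b → a < b

/-- `E` is interval-linearizable with respect to the system of objects `spec`. -/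
def GIntervalLin (spec : Obj → GISObject Proc Obj Op In Out)
    (E : List (GEv Proc Obj Op In Out)) : Prop :=
  ∃ Ebar h, Extension E Ebar ∧ IsISExec h ∧
    (∀ p, projP (comp Ebar) p = projPIS h p) ∧
    (∀ X, projObjIS h X ∈ GISS (spec X)) ∧
    Respects (comp Ebar) h

/-- `E` (an execution all of whose events are on one object) is interval-linearizable
with respect to the single object `O`. -/
def GIntervalLinOn (O : GISObject Proc Obj Op In Out)
    (E : List (GEv Proc Obj Op In Out)) : Prop :=
  ∃ Ebar h, Extension E Ebar ∧ h ∈ GISS O ∧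
    (∀ p, projP (comp Ebar) p = projPIS h p) ∧
    Respects (comp Ebar) h

set_option linter.unusedSectionVars false

section Filtering

variable {α : Type*}

/-- The number of entries satisfying `P` strictly before position `i`. -/
def cntBefore (P : α → Bool) (l : List α) (i : ℕ) : ℕ :=
  ((l.take i).filter P).length

theorem filter_getElem?_cntBefore {P : α → Bool} {l : List α} {i : ℕ} {x : α}
    (hx : l[i]? = some x) (hP : P x = true) :
    (l.filter P)[cntBefore P l i]? = some x := by
  induction l generalizing i with
  | nil => simp at hx
  | cons a l ih =>
    cases i with
    | zero => simp at hx; subst hx; simp [cntBefore, hP]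
    | succ i =>
      have := ih (i := i) (by simpa using hx)
      by_cases ha : P a = true <;> simpa [cntBefore, ha] using this

theorem exists_cntBefore_of_filter_getElem? {P : α → Bool} {l : List α} {k : ℕ} {x : α}
    (hx : (l.filter P)[k]? = some x) :
    ∃ i, cntBefore P l i = k ∧ l[i]? = some x ∧ P x = true := by
  induction l generalizing k with
  | nil => simp at hx
  | cons a l ih =>
    by_cases ha : P a = true
    · cases k with
      | zero =>
        simp [ha] at hx; subst hx
        exact ⟨0, by simp [cntBefore], by simp, ha⟩
      | succ k =>
        obtain ⟨i, h1, h2, h3⟩ := ih (k := k) (by simpa [ha] using hx)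
        exact ⟨i + 1, by simpa [cntBefore, ha] using h1, by simpa using h2, h3⟩
    · obtain ⟨i, h1, h2, h3⟩ := ih (k := k) (by simpa [ha] using hx)
      exact ⟨i + 1, by simpa [cntBefore, ha] using h1, by simpa using h2, h3⟩

open Classical in
theorem cntBefore_eq_card (P : α → Bool) (l : List α) (i : ℕ) :
    cntBefore P l i =
      ((Finset.range i).filter (fun j => ∃ x, l[j]? = some x ∧ P x = true)).card := by
  induction i with
  | zero => simp [cntBefore]
  | succ i ih =>
    rw [Finset.range_add_one, Finset.filter_insert]
    rcases hx : l[i]? with _ | x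
    · simpa [cntBefore, List.take_add_one, hx] using ih
    · by_cases hP : P x = true <;> simpa [cntBefore, List.take_add_one, hx, hP] using ih

theorem cntBefore_mono (P : α → Bool) (l : List α) : Monotone (cntBefore P l) := by
  intro i j hij
  exact ((List.take_prefix_take_left hij).sublist.filter P).length_le

theorem cntBefore_lt {P : α → Bool} {l : List α} {i j : ℕ} {x : α}
    (hx : l[i]? = some x) (hP : P x = true) (hij : i < j) :
    cntBefore P l i < cntBefore P l j := by
  refine lt_of_lt_of_le ?_ (cntBefore_mono P l (Nat.succ_le_of_lt hij))
  simp [cntBefore, List.take_add_one, hx, hP]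

theorem cntBefore_inj {P : α → Bool} {l : List α} {i j : ℕ} {x y : α}
    (hx : l[i]? = some x) (hPx : P x = true) (hy : l[j]? = some y) (hPy : P y = true)
    (h : cntBefore P l i = cntBefore P l j) : i = j := by
  rcases lt_trichotomy i j with hij | hij | hij
  · exact absurd h (cntBefore_lt hx hPx hij).ne
  · exact hij
  · exact absurd h (cntBefore_lt hy hPy hij).ne'

end Filtering

section Alternation


@[simp]
theorem GEv.obj_inv (p : Proc) (X : Obj) (o : Op) (x : In) :
    (GEv.inv p X o x : GEv Proc Obj Op In Out).obj = X := rfl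

@[simp]
theorem GEv.obj_res (p : Proc) (X : Obj) (o : Op) (y : Out) :
    (GEv.res p X o y : GEv Proc Obj Op In Out).obj = X := rfl

@[simp]
theorem GEv.isInv_inv (p : Proc) (X : Obj) (o : Op) (x : In) :
    (GEv.inv p X o x : GEv Proc Obj Op In Out).isInv = true := rfl

@[simp]
theorem GEv.isInv_res (p : Proc) (X : Obj) (o : Op) (y : Out) :
    (GEv.res p X o y : GEv Proc Obj Op In Out).isInv = false := rfl

@[simp]
theorem GEv.isRes_eq_not_isInv (e : GEv Proc Obj Op In Out) : e.isRes = !e.isInv := by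
  cases e <;> rfl

theorem procAlt_getElem?_isInv {l : List (GEv Proc Obj Op In Out)} (hl : procAlt l)
    {m : ℕ} {e : GEv Proc Obj Op In Out} (he : l[m]? = some e) :
    e.isInv = true ↔ m % 2 = 0 := by
  induction l using procAlt.induct generalizing m with
  | case1 => simp at he
  | case2 =>
    cases m with
    | zero => simp at he; subst he; simp 
    | succ m => simp at he
  | case3 p X o x p' X' o' y rest ih =>
    obtain ⟨-, -, hr⟩ := hl
    match m with
    | 0 => simp at he; subst he; simp 
    | 1 => simp at he; subst he; simp 
    | m + 2 =>
      have := ih hr (m := m) (by simpa using he)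
      rw [this]; omega
  | case4 l h1 h2 h3 => simp [procAlt] at hl

theorem procAlt_getElem?_obj {l : List (GEv Proc Obj Op In Out)} (hl : procAlt l)
    {k : ℕ} {e f : GEv Proc Obj Op In Out} (he : l[2 * k]? = some e)
    (hf : l[2 * k + 1]? = some f) : e.obj = f.obj := by
  induction l using procAlt.induct generalizing k with
  | case1 => simp at he
  | case2 => simp at hf
  | case3 p X o x p' X' o' y rest ih =>
    obtain ⟨hX, -, hr⟩ := hl
    cases k with
    | zero => simp at he hf; subst he hf; exact hX
    | succ k =>
      exact ih hr (k := k) (by simpa [Nat.mul_succ] using he)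
        (by simpa [Nat.mul_succ] using hf)
  | case4 l h1 h2 h3 => simp [procAlt] at hl

theorem procAlt.filter_obj {l : List (GEv Proc Obj Op In Out)} (hl : procAlt l) (X : Obj) :
    procAlt (l.filter (fun e => decide (e.obj = X))) := by
  induction l using procAlt.induct with
  | case1 => trivial
  | case2 p Y o x => by_cases h : Y = X <;> simp [h, procAlt]
  | case3 p Y o x p' Y' o' y rest ih =>
    obtain ⟨rfl, rfl, hr⟩ := hl
    by_cases h : Y = X <;> simp [h, procAlt, ih hr]
  | case4 l h1 h2 h3 => simp [procAlt] at hl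

theorem procAlt.append_response {l : List (GEv Proc Obj Op In Out)} {p p' : Proc} {X : Obj}
    {o : Op} {x : In} {y : Out} (hl : procAlt (l ++ [.inv p X o x])) :
    procAlt (l ++ [.inv p X o x] ++ [.res p' X o y]) := by
  induction l using procAlt.induct with
  | case1 => simp [procAlt]
  | case2 => simp [procAlt] at hl
  | case3 q Y o x q' Y' o' y rest ih =>
    obtain ⟨h1, h2, hr⟩ := hl
    exact ⟨h1, h2, ih hr⟩
  | case4 l h1 h2 h3 =>
    match l with
    | [] => simp at h1
    | [.inv _ _ _ _] => exact (h2 _ _ _ _ rfl).elim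
    | .inv _ _ _ _ :: .res _ _ _ _ :: _ => exact (h3 _ _ _ _ _ _ _ _ _ rfl).elim
    | .res _ _ _ _ :: _ => simp [procAlt] at hl
    | .inv _ _ _ _ :: .inv _ _ _ _ :: _ => simp [procAlt] at hl

theorem procAlt.eq_of_append_responses {l f : List (GEv Proc Obj Op In Out)}
    (hl : procAlt (l ++ f)) (hf : ∀ e ∈ f, e.isRes = true) :
    f = [] ∨ ∃ l' p p' X o x y, l = l' ++ [.inv p X o x] ∧ f = [.res p' X o y] := by
  induction l using procAlt.induct with
  | case1 =>
    match f with
    | [] => simp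
    | .res _ _ _ _ :: _ => simp [procAlt] at hl
    | .inv _ _ _ _ :: _ => simp  at hf
  | case2 p X o x =>
    match f with
    | [] => simp
    | [.res p' X' o' y] =>
      obtain ⟨rfl, rfl, -⟩ := hl
      exact Or.inr ⟨[], p, p', X, o, x, y, by simp⟩
    | .inv _ _ _ _ :: _ => simp  at hf
    | .res _ _ _ _ :: .res _ _ _ _ :: _ => simp [procAlt] at hl
    | .res _ _ _ _ :: .inv _ _ _ _ :: _ => simp  at hf
  | case3 q Y o x q' Y' o' y rest ih =>
    obtain ⟨-, -, hr⟩ := hl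
    rcases ih hr with h | ⟨l', p, p', X, o'', x', y', h, h'⟩
    · exact Or.inl h
    · exact Or.inr ⟨.inv q Y o x :: .res q' Y' o' y :: l', p, p', X, o'', x', y', by simp [h], h'⟩
  | case4 l h1 h2 h3 =>
    match l with
    | [] => simp at h1
    | [.inv _ _ _ _] => exact (h2 _ _ _ _ rfl).elim
    | .inv _ _ _ _ :: .res _ _ _ _ :: _ => exact (h3 _ _ _ _ _ _ _ _ _ rfl).elim
    | .res _ _ _ _ :: _ => simp [procAlt] at hl
    | .inv _ _ _ _ :: .inv _ _ _ _ :: _ => simp [procAlt] at hl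

theorem procAlt.getLast?_of_filter_obj {l : List (GEv Proc Obj Op In Out)} (hl : procAlt l)
    {X : Obj} {e : GEv Proc Obj Op In Out}
    (he : (l.filter (fun e => decide (e.obj = X))).getLast? = some e) (hi : e.isInv = true) :
    l.getLast? = some e := by
  induction l using procAlt.induct with
  | case1 => simp at he
  | case2 p Y o x =>
    by_cases h : Y = X
    · simpa [h] using he
    · simp [h] at he
  | case3 p Y o x p' Y' o' y rest ih =>
    obtain ⟨rfl, rfl, hr⟩ := hl
    rcases hn : (rest.filter (fun e => decide (e.obj = X))).getLast? with _ | f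
    · have hn' := List.getLast?_eq_none_iff.mp hn
      by_cases h : Y = X
      · simp [h, hn'] at he
        subst he; simp  at hi
      · simp [h, hn'] at he
    · have hf : f = e := by
        by_cases h : Y = X <;>
          simpa [h, List.getLast?_cons, hn] using he
      subst hf
      simp [List.getLast?_cons, ih hr hn]
  | case4 l h1 h2 h3 => simp [procAlt] at hl

end Alternation

section Completion

theorem comp_cons (e : GEv Proc Obj Op In Out) (E : List (GEv Proc Obj Op In Out)) :
    comp (e :: E) =
      if e.isInv && E.all (fun e' => !decide (e'.proc = e.proc)) then comp E
      else e :: comp E := by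
  unfold comp
  rw [List.length_cons, List.range_succ_eq_map, List.filterMap_cons, List.filterMap_map]
  by_cases h : (e.isInv && E.all (fun e' => !decide (e'.proc = e.proc))) = true
  · simp only [List.getElem?_cons_zero, Option.bind_some, zero_add, List.drop_succ_cons,
      List.drop_zero, h, if_true]
    rfl
  · simp only [List.getElem?_cons_zero, Option.bind_some, zero_add, List.drop_succ_cons,
      List.drop_zero, h]
    rfl

theorem comp_filter {P : GEv Proc Obj Op In Out → Bool} {E : List (GEv Proc Obj Op In Out)}
    (h : ∀ E₁ e E₂, E = E₁ ++ e :: E₂ → P e = true → e.isInv = true →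
      (∃ f ∈ E₂, f.proc = e.proc) → ∃ f ∈ E₂, P f = true ∧ f.proc = e.proc) :
    comp (E.filter P) = (comp E).filter P := by
  induction E with
  | nil => rfl
  | cons e E ih =>
    have ih := ih fun E₁ e' E₂ hE => h (e :: E₁) e' E₂ (by simp [hE])
    have h0 := h [] e E rfl
    rw [comp_cons]
    by_cases hP : P e = true
    · rw [List.filter_cons_of_pos hP, comp_cons, ih]
      have : (e.isInv && (E.filter P).all (fun e' => !decide (e'.proc = e.proc))) =
          (e.isInv && E.all (fun e' => !decide (e'.proc = e.proc))) := by
        rw [Bool.eq_iff_iff]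
        simp only [Bool.and_eq_true, List.all_eq_true, List.mem_filter, Bool.not_eq_true',
          decide_eq_false_iff_not]
        refine and_congr_right fun hi => ⟨fun H f hf hfe => ?_, fun H f hf => H f hf.1⟩
        obtain ⟨g, hg, hgP, hge⟩ := h0 hP hi ⟨f, hf, hfe⟩
        exact H g ⟨hg, hgP⟩ hge
      rw [this]
      split_ifs <;> simp [hP]
    · rw [List.filter_cons_of_neg hP, ih]
      split_ifs <;> simp [hP]

theorem projP_comp (E : List (GEv Proc Obj Op In Out)) (p : Proc) :
    projP (comp E) p = comp (projP E p) := by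
  refine (comp_filter ?_).symm
  rintro E₁ e E₂ - he - ⟨f, hf, hfe⟩
  exact ⟨f, hf, by simpa [hfe] using he, hfe⟩

theorem projObj_comp {E : List (GEv Proc Obj Op In Out)} (hE : WF E) (X : Obj) :
    projObj (comp E) X = comp (projObj E X) := by
  refine (comp_filter ?_).symm
  rintro E₁ e E₂ rfl he hi ⟨f, hf, hfe⟩
  have hp := hE e.proc
  have hsplit : projP (E₁ ++ e :: E₂) e.proc = projP E₁ e.proc ++ e :: projP E₂ e.proc := by
    simp [projP]
  rw [hsplit] at hp
  rcases hg : projP E₂ e.proc with _ | ⟨g, l⟩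
  · have : f ∈ projP E₂ e.proc := by simp [projP, hf, hfe]
    simp [hg] at this
  · rw [hg] at hp
    have hgm : g ∈ projP E₂ e.proc := by simp [hg]
    have hgm' : g ∈ E₂ ∧ g.proc = e.proc := by simpa [projP] using hgm
    have h0 : (projP E₁ e.proc ++ e :: g :: l)[(projP E₁ e.proc).length]? = some e := by simp
    have h1 : (projP E₁ e.proc ++ e :: g :: l)[(projP E₁ e.proc).length + 1]? = some g := by
      rw [List.getElem?_append_right (by omega)]; simp
    have hev := (procAlt_getElem?_isInv hp h0).1 hi
    obtain ⟨k, hk⟩ : ∃ k, (projP E₁ e.proc).length = 2 * k :=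
      ⟨_, (Nat.mul_div_cancel' (Nat.dvd_of_mod_eq_zero hev)).symm⟩
    rw [hk] at h0 h1
    refine ⟨g, hgm'.1, ?_, hgm'.2⟩
    simpa [← procAlt_getElem?_obj hp h0 h1] using he

protected theorem procAlt.comp {l : List (GEv Proc Obj Op In Out)} (hl : procAlt l) {p : Proc}
    (hp : ∀ e ∈ l, e.proc = p) : procAlt (comp l) := by
  induction l using procAlt.induct with
  | case1 => trivial
  | case2 p X o x => simp [_root_.comp, procAlt]
  | case3 q X o x q' X' o' y rest ih =>
    obtain ⟨rfl, rfl, hr⟩ := hl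
    have h1 := hp (.inv q X o x) (by simp)
    have h2 := hp (.res q' X o y) (by simp)
    have ih := ih hr fun e he => hp e (by simp [he])
    simpa [comp_cons, h1, h2, procAlt] using ih
  | case4 l h1 h2 h3 => simp [procAlt] at hl

protected theorem WF.comp {E : List (GEv Proc Obj Op In Out)} (hE : WF E) : WF (comp E) := by
  intro p
  rw [projP_comp]
  exact (hE p).comp (p := p) fun e he => by simpa [projP] using (List.mem_filter.1 he).2

theorem projP_projObj (E : List (GEv Proc Obj Op In Out)) (X : Obj) (p : Proc) :
    projP (projObj E X) p = (projP E p).filter (fun e => decide (e.obj = X)) := by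
  simp only [projP, projObj, List.filter_filter]
  congr 1
  funext e
  exact Bool.and_comm _ _

protected theorem WF.projObj {E : List (GEv Proc Obj Op In Out)} (hE : WF E) (X : Obj) :
    WF (projObj E X) := by
  intro p
  rw [projP_projObj]
  exact (hE p).filter_obj X

end Completion

section Positions

/-- The number of events of process `p` strictly before position `i`. -/
abbrev procRank (E : List (GEv Proc Obj Op In Out)) (p : Proc) (i : ℕ) : ℕ :=
  cntBefore (fun e => decide (e.proc = p)) E i

theorem projP_getElem?_procRank {E : List (GEv Proc Obj Op In Out)} {i : ℕ}
    {e : GEv Proc Obj Op In Out} (he : E[i]? = some e) :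
    (projP E e.proc)[procRank E e.proc i]? = some e :=
  filter_getElem?_cntBefore he (by simp)

theorem exists_procRank_of_projP_getElem? {E : List (GEv Proc Obj Op In Out)} {p : Proc} {k : ℕ}
    {e : GEv Proc Obj Op In Out} (he : (projP E p)[k]? = some e) :
    ∃ i, procRank E p i = k ∧ E[i]? = some e ∧ e.proc = p := by
  simpa using exists_cntBefore_of_filter_getElem? he

theorem WF.isInv_iff {E : List (GEv Proc Obj Op In Out)} (hE : WF E) {i : ℕ}
    {e : GEv Proc Obj Op In Out} (he : E[i]? = some e) :
    e.isInv = true ↔ procRank E e.proc i % 2 = 0 :=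
  procAlt_getElem?_isInv (hE e.proc) (projP_getElem?_procRank he)

/-- A response is immediately preceded, among the events of its process, by its invocation. -/
theorem WF.exists_pred {E : List (GEv Proc Obj Op In Out)} (hE : WF E) {u : ℕ}
    {e : GEv Proc Obj Op In Out} (he : E[u]? = some e) (hr : e.isRes = true) :
    ∃ v f, v < u ∧ E[v]? = some f ∧ f.isInv = true ∧ f.proc = e.proc ∧ f.obj = e.obj ∧
      ∀ w g, E[w]? = some g → g.proc = e.proc → v < w → w < u → False := by
  have hodd := (hE.isInv_iff he).not
  simp only [GEv.isRes_eq_not_isInv, Bool.not_eq_true'] at hr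
  simp only [hr, Bool.false_eq_true, not_false_eq_true, true_iff] at hodd
  obtain ⟨k, hk⟩ : ∃ k, procRank E e.proc u = 2 * k + 1 := ⟨procRank E e.proc u / 2, by omega⟩
  have h1 := projP_getElem?_procRank he
  rw [hk] at h1
  have hlt : 2 * k < (projP E e.proc).length := by
    have := (List.getElem?_eq_some_iff.1 h1).1; omega
  have h0 := List.getElem?_eq_getElem hlt
  set f := (projP E e.proc)[2 * k]
  obtain ⟨v, hv, hvf, hfp⟩ := exists_procRank_of_projP_getElem? h0
  refine ⟨v, f, ?_, hvf, ?_, hfp, procAlt_getElem?_obj (hE _) h0 h1, ?_⟩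
  · by_contra hc
    have := cntBefore_mono (fun e' => decide (e'.proc = e.proc)) E (not_lt.1 hc)
    simp only [procRank] at hv hk
    omega
  · exact (procAlt_getElem?_isInv (hE _) h0).2 (by omega)
  · intro w g hg hgp hvw hwu
    have a := cntBefore_lt (P := fun e' => decide (e'.proc = e.proc)) hvf (by simp [hfp]) hvw
    have b := cntBefore_lt (P := fun e' => decide (e'.proc = e.proc)) hg (by simp [hgp]) hwu
    simp only [procRank] at hv hk
    omega

/-- An invocation followed by another event of its process is followed first by its response. -/
theorem WF.exists_succ {E : List (GEv Proc Obj Op In Out)} (hE : WF E) {u v : ℕ}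
    {e f : GEv Proc Obj Op In Out} (he : E[u]? = some e) (hi : e.isInv = true)
    (hf : E[v]? = some f) (hfe : f.proc = e.proc) (huv : u < v) :
    ∃ w g, u < w ∧ w ≤ v ∧ E[w]? = some g ∧ g.isRes = true ∧ g.proc = e.proc ∧
      g.obj = e.obj := by
  have hev := (hE.isInv_iff he).1 hi
  obtain ⟨k, hk⟩ : ∃ k, procRank E e.proc u = 2 * k := ⟨procRank E e.proc u / 2, by omega⟩
  have h0 := projP_getElem?_procRank he
  have hv := projP_getElem?_procRank hf
  rw [hk] at h0
  rw [hfe] at hv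
  have hlt' := cntBefore_lt (P := fun e' => decide (e'.proc = e.proc)) he (by simp) huv
  have hlt : 2 * k + 1 < (projP E e.proc).length := by
    have := (List.getElem?_eq_some_iff.1 hv).1
    simp only [procRank] at this hk
    omega
  have h1 := List.getElem?_eq_getElem hlt
  set g := (projP E e.proc)[2 * k + 1]
  obtain ⟨w, hw, hwg, hgp⟩ := exists_procRank_of_projP_getElem? h1
  have hmono := cntBefore_mono (fun e' => decide (e'.proc = e.proc)) E
  refine ⟨w, g, ?_, ?_, hwg, ?_, hgp, (procAlt_getElem?_obj (hE _) h0 h1).symm⟩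
  · by_contra hc
    have := hmono (not_lt.1 hc)
    simp only [procRank] at hw hk
    omega
  · by_contra hc
    have := cntBefore_lt (P := fun e' => decide (e'.proc = e.proc)) hf (by simp [hfe])
      (not_le.1 hc)
    simp only [procRank] at hw hk
    omega
  · have := (procAlt_getElem?_isInv (hE _) h1).not.2 (by omega)
    simpa using this

end Positions

section ClassMap

/-- No class of `h` contains two events of one process. -/
def UniqPerProc (h : List (Finset (GEv Proc Obj Op In Out))) : Prop :=
  ∀ C ∈ h, ∀ e ∈ C, ∀ f ∈ C, e.proc = f.proc → e = f

theorem IsISExec.uniqPerProc {h : List (Finset (GEv Proc Obj Op In Out))} (hh : IsISExec h) :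
    UniqPerProc h := by
  intro C hC
  obtain ⟨k, hk⟩ := List.mem_iff_getElem?.1 hC
  have := hh.2.1 k C hk
  split_ifs at this
  · exact this.2.2
  · exact this.2.2

/-- The number of classes of `h` before position `a` with an event of process `p`. -/
abbrev classRank (h : List (Finset (GEv Proc Obj Op In Out))) (p : Proc) (a : ℕ) : ℕ :=
  cntBefore (fun C => decide (C.filter (fun e => e.proc = p)).Nonempty) h a

theorem filter_proc_eq_singleton {C : Finset (GEv Proc Obj Op In Out)}
    (hC : ∀ e ∈ C, ∀ f ∈ C, e.proc = f.proc → e = f) {e : GEv Proc Obj Op In Out} (he : e ∈ C) :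
    C.filter (fun f => f.proc = e.proc) = {e} := by
  ext f
  simp only [Finset.mem_filter, Finset.mem_singleton]
  exact ⟨fun hf => hC f hf.1 e he hf.2, by rintro rfl; exact ⟨he, rfl⟩⟩

theorem projPIS_getElem?_classRank {h : List (Finset (GEv Proc Obj Op In Out))}
    (hh : UniqPerProc h) {a : ℕ} {C : Finset (GEv Proc Obj Op In Out)}
    {e : GEv Proc Obj Op In Out} (hC : h[a]? = some C) (he : e ∈ C) :
    (projPIS h e.proc)[classRank h e.proc a]? = some e := by
  induction h generalizing a with
  | nil => simp at hC
  | cons D h ih =>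
    have ih := @ih (fun C hC => hh C (by simp [hC]))
    cases a with
    | zero =>
      simp only [List.getElem?_cons_zero, Option.some.injEq] at hC
      subst hC
      simp [projPIS, cntBefore, filter_proc_eq_singleton (hh D (by simp)) he]
    | succ a =>
      have := ih (a := a) (by simpa using hC)
      rcases (D.filter (fun f => f.proc = e.proc)).eq_empty_or_nonempty with hD | ⟨f, hf⟩
      · simpa [projPIS, cntBefore, hD] using this
      · obtain ⟨hf, hfe⟩ := Finset.mem_filter.1 hf
        have hs := filter_proc_eq_singleton (hh D (by simp)) hf
        rw [hfe] at hs
        simpa [projPIS, cntBefore, hs] using this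

theorem exists_classRank_of_projPIS_getElem? {h : List (Finset (GEv Proc Obj Op In Out))}
    (hh : UniqPerProc h) {p : Proc} {m : ℕ} {e : GEv Proc Obj Op In Out}
    (he : (projPIS h p)[m]? = some e) :
    ∃ a C, h[a]? = some C ∧ e ∈ C ∧ e.proc = p ∧ classRank h p a = m := by
  induction h generalizing m with
  | nil => simp [projPIS] at he
  | cons D h ih =>
    have ih := @ih (fun C hC => hh C (by simp [hC]))
    rcases (D.filter (fun f => f.proc = p)).eq_empty_or_nonempty with hD | ⟨f, hf⟩
    · obtain ⟨a, C, h1, h2, h3, h4⟩ := ih (m := m) (by simpa [projPIS, hD] using he)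
      exact ⟨a + 1, C, by simpa using h1, h2, h3, by simpa [cntBefore, hD] using h4⟩
    · obtain ⟨hfD, rfl⟩ := Finset.mem_filter.1 hf
      have hs := filter_proc_eq_singleton (hh D (by simp)) hfD
      cases m with
      | zero =>
        simp [projPIS, hs] at he
        subst he
        exact ⟨0, D, by simp, hfD, rfl, by simp [cntBefore]⟩
      | succ m =>
        obtain ⟨a, C, h1, h2, h3, h4⟩ := ih (m := m) (by simpa [projPIS, hs] using he)
        exact ⟨a + 1, C, by simpa using h1, h2, h3, by simpa [cntBefore, hs] using h4⟩

theorem evInClassAt_iff {h : List (Finset (GEv Proc Obj Op In Out))} {p : Proc} {m a : ℕ} :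
    evInClassAt h p m a ↔
      (∃ C e, h[a]? = some C ∧ e ∈ C ∧ e.proc = p) ∧ classRank h p a = m := by
  unfold evInClassAt
  refine and_congr ⟨?_, ?_⟩ Iff.rfl
  · rintro ⟨C, h1, e, h2, h3⟩; exact ⟨C, e, h1, h2, h3⟩
  · rintro ⟨C, e, h1, h2, h3⟩; exact ⟨C, h1, e, h2, h3⟩

/-- `cls` places the event at each position of `G` into a class of `h`, so that every class
consists exactly of the events placed in it, and process order and real-time order are
respected. -/
structure ClassMap (G : List (GEv Proc Obj Op In Out))
    (h : List (Finset (GEv Proc Obj Op In Out))) (cls : ℕ → ℕ) : Prop where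
  mem : ∀ u e, G[u]? = some e → ∃ C, h[cls u]? = some C ∧ e ∈ C
  surj : ∀ a C e, h[a]? = some C → e ∈ C → ∃ u, G[u]? = some e ∧ cls u = a
  mono : ∀ u v e f, G[u]? = some e → G[v]? = some f → e.proc = f.proc → u < v → cls u < cls v
  rt : ∀ u v e f, G[u]? = some e → G[v]? = some f → e.isRes = true → f.isInv = true →
    u < v → cls u < cls v

theorem exists_classMap {G : List (GEv Proc Obj Op In Out)}
    {h : List (Finset (GEv Proc Obj Op In Out))} (hG : WF G) (hh : UniqPerProc h)
    (hproj : ∀ p, projP G p = projPIS h p) (hresp : Respects G h) :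
    ∃ cls, ClassMap G h cls := by
  have key : ∀ u, ∃ a, ∀ e, G[u]? = some e →
      (∃ C, h[a]? = some C ∧ e ∈ C) ∧ classRank h e.proc a = procRank G e.proc u := by
    intro u
    rcases hu : G[u]? with _ | e
    · simp
    · have := projP_getElem?_procRank hu
      rw [hproj] at this
      obtain ⟨a, C, h1, h2, -, h4⟩ := exists_classRank_of_projPIS_getElem? hh this
      refine ⟨a, fun e' he' => ?_⟩
      obtain rfl : e = e' := by simpa using he'
      exact ⟨⟨C, h1, h2⟩, h4⟩
  choose cls hcls using key
  have at' : ∀ u e, G[u]? = some e → evInClassAt h e.proc (procRank G e.proc u) (cls u) := by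
    intro u e he
    obtain ⟨⟨C, hC, heC⟩, hr⟩ := hcls u e he
    exact evInClassAt_iff.2 ⟨⟨C, e, hC, heC, rfl⟩, hr⟩
  refine ⟨cls, fun u e he => (hcls u e he).1, ?_, ?_, ?_⟩
  · intro a C e hC he
    have := projPIS_getElem?_classRank hh hC he
    rw [← hproj] at this
    obtain ⟨u, h1, h2, -⟩ := exists_procRank_of_projP_getElem? this
    refine ⟨u, h2, ?_⟩
    obtain ⟨⟨D, hD, heD⟩, hr⟩ := hcls u e h2
    refine cntBefore_inj hD ?_ hC ?_ (hr.trans h1)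
    · exact decide_eq_true ⟨e, by simp [heD]⟩
    · exact decide_eq_true ⟨e, by simp [he]⟩
  · intro u v e f he hf hef huv
    have h1 := (hcls u e he).2
    have h2 := (hcls v f hf).2
    rw [← hef] at h2
    have h3 := cntBefore_lt (P := fun e' => decide (e'.proc = e.proc)) he (by simp) huv
    by_contra hc
    have := cntBefore_mono (fun C => decide (C.filter (fun e' => e'.proc = e.proc)).Nonempty) h
      (not_lt.1 hc)
    simp only [procRank, classRank] at h1 h2
    omega
  · intro u v e f he hf her hfi huv
    have h1 : ¬ procRank G e.proc u % 2 = 0 := (hG.isInv_iff he).not.1 (by simpa using her)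
    have h2 := (hG.isInv_iff hf).1 hfi
    have e1 : 2 * (procRank G e.proc u / 2) + 1 = procRank G e.proc u := by omega
    have e2 : 2 * (procRank G f.proc v / 2) = procRank G f.proc v := by omega
    refine hresp e.proc (procRank G e.proc u / 2) f.proc (procRank G f.proc v / 2)
      ⟨u, v, ⟨⟨e, he, rfl⟩, e1.symm⟩, ⟨⟨f, hf, rfl⟩, e2.symm⟩, huv⟩ _ _ _ _
      (Or.inr e1.symm) (Or.inl e2.symm) (at' u e he) (at' v f hf)

namespace ClassMap

variable {G : List (GEv Proc Obj Op In Out)} {h : List (Finset (GEv Proc Obj Op In Out))}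
  {cls : ℕ → ℕ}

theorem inj (H : ClassMap G h cls) {u v : ℕ} {e f : GEv Proc Obj Op In Out}
    (he : G[u]? = some e) (hf : G[v]? = some f) (hef : e.proc = f.proc) (huv : cls u = cls v) :
    u = v := by
  rcases lt_trichotomy u v with h' | h' | h'
  · exact absurd huv (H.mono u v e f he hf hef h').ne
  · exact h'
  · exact absurd huv (H.mono v u f e hf he hef.symm h').ne'

theorem lt_of_cls_lt (H : ClassMap G h cls) {u v : ℕ} {e f : GEv Proc Obj Op In Out}
    (he : G[u]? = some e) (hf : G[v]? = some f) (hef : e.proc = f.proc) (huv : cls u < cls v) :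
    u < v := by
  rcases lt_trichotomy u v with h' | h' | h'
  · exact h'
  · exact absurd huv (by simp [h'])
  · exact absurd huv (H.mono v u f e hf he hef.symm h').not_gt

theorem uniqPerProc (H : ClassMap G h cls) : UniqPerProc h := by
  intro C hC e he f hf hef
  obtain ⟨a, ha⟩ := List.mem_iff_getElem?.1 hC
  obtain ⟨u, hu, hua⟩ := H.surj a C e ha he
  obtain ⟨v, hv, hva⟩ := H.surj a C f ha hf
  obtain rfl := H.inj hu hv hef (hua.trans hva.symm)
  simpa [hu] using hv

theorem classRank_cls (H : ClassMap G h cls) {u : ℕ} {e : GEv Proc Obj Op In Out}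
    (he : G[u]? = some e) : classRank h e.proc (cls u) = procRank G e.proc u := by
  classical
  rw [classRank, procRank, cntBefore_eq_card, cntBefore_eq_card]
  symm
  refine Finset.card_bij (fun v _ => cls v) ?_ ?_ ?_
  · intro v hv
    simp only [Finset.mem_filter, Finset.mem_range, decide_eq_true_eq] at hv ⊢
    obtain ⟨hvu, f, hf, hfe⟩ := hv
    obtain ⟨C, hC, hfC⟩ := H.mem v f hf
    exact ⟨H.mono v u f e hf he hfe hvu, C, hC, f, by simp [hfC, hfe]⟩
  · intro v hv w hw hvw
    simp only [Finset.mem_filter, Finset.mem_range, decide_eq_true_eq] at hv hw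
    obtain ⟨-, f, hf, hfe⟩ := hv
    obtain ⟨-, g, hg, hge⟩ := hw
    exact H.inj hf hg (hfe.trans hge.symm) hvw
  · intro a ha
    simp only [Finset.mem_filter, Finset.mem_range, decide_eq_true_eq] at ha
    obtain ⟨hau, C, hC, f, hf⟩ := ha
    obtain ⟨hfC, hfe⟩ := Finset.mem_filter.1 hf
    obtain ⟨v, hv, rfl⟩ := H.surj a C f hC hfC
    refine ⟨v, ?_, rfl⟩
    simp only [Finset.mem_filter, Finset.mem_range, decide_eq_true_eq]
    exact ⟨H.lt_of_cls_lt hv he hfe hau, f, hv, hfe⟩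

theorem projP_eq (H : ClassMap G h cls) (p : Proc) : projP G p = projPIS h p := by
  apply List.ext_getElem?
  intro m
  apply Option.ext
  intro e
  constructor
  · intro he
    obtain ⟨u, rfl, hu, rfl⟩ := exists_procRank_of_projP_getElem? he
    obtain ⟨C, hC, heC⟩ := H.mem u e hu
    rw [← H.classRank_cls hu]
    exact projPIS_getElem?_classRank H.uniqPerProc hC heC
  · intro he
    obtain ⟨a, C, hC, heC, rfl, rfl⟩ := exists_classRank_of_projPIS_getElem? H.uniqPerProc he
    obtain ⟨u, hu, rfl⟩ := H.surj a C e hC heC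
    rw [H.classRank_cls hu]
    exact projP_getElem?_procRank hu

theorem exists_of_evInClassAt (H : ClassMap G h cls) {p : Proc} {m a : ℕ}
    (ha : evInClassAt h p m a) :
    ∃ u e, G[u]? = some e ∧ e.proc = p ∧ procRank G p u = m ∧ cls u = a := by
  obtain ⟨⟨C, e, hC, heC, rfl⟩, rfl⟩ := evInClassAt_iff.1 ha
  obtain ⟨u, hu, rfl⟩ := H.surj a C e hC heC
  exact ⟨u, e, hu, rfl, (H.classRank_cls hu).symm, rfl⟩

theorem le_of_procRank_le (H : ClassMap G h cls) {u v : ℕ} {e f : GEv Proc Obj Op In Out}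
    (he : G[u]? = some e) (hf : G[v]? = some f) (hef : e.proc = f.proc)
    (huv : procRank G f.proc u ≤ procRank G f.proc v) : cls u ≤ cls v := by
  rcases lt_trichotomy u v with h' | h' | h'
  · exact (H.mono u v e f he hf hef h').le
  · rw [h']
  · exact absurd huv
      (cntBefore_lt (P := fun e' => decide (e'.proc = f.proc)) hf (by simp) h').not_ge

theorem respects (H : ClassMap G h cls) (hG : WF G) : Respects G h := by
  rintro p k q l ⟨i, j, ⟨⟨e, he, rfl⟩, hi⟩, ⟨⟨f, hf, rfl⟩, hj⟩, hij⟩ m m' a b hm hm' ha hb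
  change procRank G e.proc i = _ at hi
  change procRank G f.proc j = _ at hj
  obtain ⟨u, e', hu, hue, hum, rfl⟩ := H.exists_of_evInClassAt ha
  obtain ⟨v, f', hv, hvf, hvm, rfl⟩ := H.exists_of_evInClassAt hb
  have her : ¬ e.isInv = true := (hG.isInv_iff he).not.2 (by omega)
  have hfi : f.isInv = true := (hG.isInv_iff hf).2 (by omega)
  calc cls u ≤ cls i := H.le_of_procRank_le hu he hue (by omega)
    _ < cls j := H.rt i j e f he hf (by simpa using her) hfi hij
    _ ≤ cls v := H.le_of_procRank_le hf hv hvf.symm (by rw [hvf]; omega)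

end ClassMap

end ClassMap

section Restriction

/-- The number of classes of `h` before position `a` with an event on object `X`. -/
abbrev objClassRank (h : List (Finset (GEv Proc Obj Op In Out))) (X : Obj) (a : ℕ) : ℕ :=
  cntBefore (fun C => decide C.Nonempty) (h.map (fun C => C.filter (fun e => e.obj = X))) a

theorem projObjIS_getElem?_objClassRank {h : List (Finset (GEv Proc Obj Op In Out))} {a : ℕ}
    {C : Finset (GEv Proc Obj Op In Out)} {e : GEv Proc Obj Op In Out} (hC : h[a]? = some C)
    (he : e ∈ C) :
    (projObjIS h e.obj)[objClassRank h e.obj a]? = some (C.filter (fun f => f.obj = e.obj)) :=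
  filter_getElem?_cntBefore (by simp [hC]) (decide_eq_true ⟨e, by simp [he]⟩)

theorem ClassMap.exists_projObj {G : List (GEv Proc Obj Op In Out)}
    {h : List (Finset (GEv Proc Obj Op In Out))} {cls : ℕ → ℕ} (H : ClassMap G h cls) (X : Obj) :
    ∃ cls', ClassMap (projObj G X) (projObjIS h X) cls' := by
  set P : GEv Proc Obj Op In Out → Bool := fun e => decide (e.obj = X) with hP
  have key : ∀ k, ∃ u, ∀ e, (projObj G X)[k]? = some e →
      cntBefore P G u = k ∧ G[u]? = some e ∧ e.obj = X := by
    intro k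
    rcases hk : (projObj G X)[k]? with _ | e
    · simp
    · obtain ⟨u, h1, h2, h3⟩ := exists_cntBefore_of_filter_getElem? hk
      refine ⟨u, fun e' he' => ?_⟩
      obtain rfl : e = e' := by simpa using he'
      exact ⟨h1, h2, by simpa using h3⟩
  choose pos hpos using key
  have rank_lt : ∀ u v e, G[u]? = some e → e.obj = X → cls u < cls v →
      objClassRank h X (cls u) < objClassRank h X (cls v) := by
    rintro u v e he rfl huv
    obtain ⟨C, hC, heC⟩ := H.mem u e he
    exact cntBefore_lt (x := C.filter (fun f => f.obj = e.obj)) (by simp [hC])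
      (decide_eq_true ⟨e, by simp [heC]⟩) huv
  have pos_lt : ∀ k l e f, (projObj G X)[k]? = some e → (projObj G X)[l]? = some f → k < l →
      pos k < pos l := by
    intro k l e f he hf hkl
    by_contra hc
    have := cntBefore_mono P G (not_lt.1 hc)
    rw [(hpos k e he).1, (hpos l f hf).1] at this
    omega
  refine ⟨fun k => objClassRank h X (cls (pos k)), ?_, ?_, ?_, ?_⟩
  · intro k e he
    obtain ⟨-, hu, rfl⟩ := hpos k e he
    obtain ⟨C, hC, heC⟩ := H.mem _ e hu
    exact ⟨_, projObjIS_getElem?_objClassRank hC heC, by simp [heC]⟩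
  · intro k D e hD he
    obtain ⟨a, rfl, ha, -⟩ := exists_cntBefore_of_filter_getElem? hD
    rw [List.getElem?_map, Option.map_eq_some_iff] at ha
    obtain ⟨C, hC, rfl⟩ := ha
    obtain ⟨heC, heX⟩ := Finset.mem_filter.1 he
    obtain ⟨u, hu, rfl⟩ := H.surj a C e hC heC
    have hk : (projObj G X)[cntBefore P G u]? = some e :=
      filter_getElem?_cntBefore hu (by simp [heX])
    refine ⟨_, hk, ?_⟩
    obtain ⟨h1, h2, -⟩ := hpos _ e hk
    have : pos (cntBefore P G u) = u :=
      cntBefore_inj h2 (by simp [hP, heX]) hu (by simp [hP, heX]) h1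
    simp only [this]
  · intro k l e f he hf hef hkl
    obtain ⟨-, hu, heX⟩ := hpos k e he
    obtain ⟨-, hv, -⟩ := hpos l f hf
    exact rank_lt _ _ e hu heX (H.mono _ _ e f hu hv hef (pos_lt k l e f he hf hkl))
  · intro k l e f he hf her hfi hkl
    obtain ⟨-, hu, heX⟩ := hpos k e he
    obtain ⟨-, hv, -⟩ := hpos l f hf
    exact rank_lt _ _ e hu heX (H.rt _ _ e f hu hv her hfi (pos_lt k l e f he hf hkl))

end Restriction

section Merging

variable {α β γ : Type*}

theorem flatMap_pair_length (f g : β → α) (L : List β) :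
    (L.flatMap fun x => [f x, g x]).length = 2 * L.length := by
  induction L with
  | nil => rfl
  | cons x L ih => simp only [List.flatMap_cons, List.length_append, ih]; simp; omega

theorem flatMap_pair_getElem?_even (f g : β → α) (L : List β) (s : ℕ) :
    (L.flatMap fun x => [f x, g x])[2 * s]? = L[s]?.map f := by
  induction L generalizing s with
  | nil => rfl
  | cons x L ih =>
    cases s with
    | zero => simp
    | succ s => simpa [Nat.mul_succ] using ih s

theorem flatMap_pair_getElem?_odd (f g : β → α) (L : List β) (s : ℕ) :
    (L.flatMap fun x => [f x, g x])[2 * s + 1]? = L[s]?.map g := by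
  induction L generalizing s with
  | nil => rfl
  | cons x L ih =>
    cases s with
    | zero => simp
    | succ s => simpa [Nat.mul_succ] using ih s

theorem flatMap_range_getD_pair {l : List α} (hl : l.length % 2 = 0) (d : α) :
    ((List.range (l.length / 2)).flatMap fun i => [l.getD (2 * i) d, l.getD (2 * i + 1) d]) =
      l := by
  apply List.ext_getElem?
  intro a
  obtain ⟨s, rfl | rfl⟩ : ∃ s, a = 2 * s ∨ a = 2 * s + 1 := ⟨a / 2, by omega⟩
  · rw [flatMap_pair_getElem?_even]
    by_cases hs : s < l.length / 2
    · have : 2 * s < l.length := by omega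
      simp [hs, this]
    · have : l.length ≤ 2 * s := by omega
      simp [hs, this]
  · rw [flatMap_pair_getElem?_odd]
    by_cases hs : s < l.length / 2
    · have : 2 * s + 1 < l.length := by omega
      simp [hs, this]
    · have : l.length ≤ 2 * s + 1 := by omega
      simp [hs, this]

theorem Finset.exists_list_pairwise_lt [LinearOrder γ] (S : Finset β) {K : β → γ}
    (hK : Set.InjOn K S) :
    ∃ L : List β, (∀ x, x ∈ L ↔ x ∈ S) ∧ L.Pairwise (fun x y => K x < K y) := by
  refine ⟨S.toList.mergeSort (fun x y => decide (K x ≤ K y)), fun x => by simp, ?_⟩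
  have h1 : (S.toList.mergeSort (fun x y => decide (K x ≤ K y))).Pairwise
      (fun x y => decide (K x ≤ K y) = true) :=
    List.pairwise_mergeSort (by simpa using fun a b c => le_trans)
      (by simpa using fun a b => le_total (K a) (K b)) _
  have h2 : (S.toList.mergeSort (fun x y => decide (K x ≤ K y))).Nodup :=
    (List.mergeSort_perm _ _).nodup_iff.2 S.nodup_toList
  refine (h1.and h2).imp_of_mem fun {x y} hx hy hxy => ?_
  have hx : x ∈ S := by simpa using hx
  have hy : y ∈ S := by simpa using hy
  exact lt_of_le_of_ne (by simpa using hxy.1) fun h => hxy.2 (hK hx hy h)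

theorem List.Pairwise.idxOf_lt [BEq β] [LawfulBEq β] [LinearOrder γ] {L : List β} {K : β → γ}
    (hL : L.Pairwise (fun x y => K x < K y)) {x y : β} (hx : x ∈ L) (hy : y ∈ L)
    (hxy : K x < K y) : L.idxOf x < L.idxOf y := by
  by_contra hc
  rcases (not_lt.1 hc).lt_or_eq with h | h
  · have := List.pairwise_iff_getElem.1 hL _ _ (List.idxOf_lt_length_iff.2 hy)
      (List.idxOf_lt_length_iff.2 hx) h
    simp only [List.getElem_idxOf] at this
    exact absurd this hxy.not_gt
  · rw [List.idxOf_inj hy] at h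
    exact absurd hxy (by simp [h])

theorem projObjIS_flatMap_pair {L : List (Obj × ℕ)}
    {A B : Obj × ℕ → Finset (GEv Proc Obj Op In Out)}
    (hA : ∀ x ∈ L, (A x).Nonempty ∧ ∀ e ∈ A x, e.obj = x.1)
    (hB : ∀ x ∈ L, (B x).Nonempty ∧ ∀ e ∈ B x, e.obj = x.1) (X : Obj) :
    projObjIS (L.flatMap fun x => [A x, B x]) X =
      (L.filter (fun x => decide (x.1 = X))).flatMap fun x => [A x, B x] := by
  induction L with
  | nil => rfl
  | cons x L ih =>
    have ih := ih (fun y hy => hA y (by simp [hy])) (fun y hy => hB y (by simp [hy]))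
    obtain ⟨hA1, hA2⟩ := hA x (by simp)
    obtain ⟨hB1, hB2⟩ := hB x (by simp)
    unfold projObjIS at ih ⊢
    rw [List.flatMap_cons, List.map_append, List.filter_append, ih]
    by_cases hX : x.1 = X
    · have a : (A x).filter (fun e => e.obj = X) = A x :=
        Finset.filter_true_of_mem fun e he => (hA2 e he).trans hX
      have b : (B x).filter (fun e => e.obj = X) = B x :=
        Finset.filter_true_of_mem fun e he => (hB2 e he).trans hX
      simp [a, b, hX, hA1, hB1]
    · have a : (A x).filter (fun e => e.obj = X) = ∅ :=
        Finset.filter_false_of_mem fun e he => by rw [hA2 e he]; exact hX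
      have b : (B x).filter (fun e => e.obj = X) = ∅ :=
        Finset.filter_false_of_mem fun e he => by rw [hB2 e he]; exact hX
      simp [a, b, hX]

theorem IsISExec.isInv_iff {h : List (Finset (GEv Proc Obj Op In Out))} (hh : IsISExec h)
    {a : ℕ} {C : Finset (GEv Proc Obj Op In Out)} {e : GEv Proc Obj Op In Out}
    (hC : h[a]? = some C) (he : e ∈ C) : e.isInv = true ↔ a % 2 = 0 := by
  have := hh.2.1 a C hC
  split_ifs at this with ha
  · simp [ha, this.2.1 e he]
  · have := this.2.1 e he
    simp only [GEv.isRes_eq_not_isInv, Bool.not_eq_true'] at this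
    simp [ha, this]

theorem IsISExec.class_nonempty {h : List (Finset (GEv Proc Obj Op In Out))} (hh : IsISExec h)
    {a : ℕ} {C : Finset (GEv Proc Obj Op In Out)} (hC : h[a]? = some C) : C.Nonempty := by
  have := hh.2.1 a C hC
  split_ifs at this
  · exact this.1
  · exact this.1

/-- With alternating classes of the right kinds, matching of the responses is automatic. -/
theorem ClassMap.isISExec {G : List (GEv Proc Obj Op In Out)}
    {h : List (Finset (GEv Proc Obj Op In Out))} {cls : ℕ → ℕ} (H : ClassMap G h cls)
    (hG : WF G) (hlen : h.length % 2 = 0)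
    (hcl : ∀ k C, h[k]? = some C → if k % 2 = 0 then InvClass C else ResClass C) :
    IsISExec h := by
  refine ⟨hlen, hcl, fun i C r hC hi hr => ?_⟩
  have hrr : r.isRes = true := by
    have := hcl i C hC
    rw [if_neg (by omega)] at this
    exact this.2.1 r hr
  obtain ⟨u, hu, rfl⟩ := H.surj i C r hC hr
  obtain ⟨v, f, hvu, hv, hfi, hfp, -, hbet⟩ := hG.exists_pred hu hrr
  obtain ⟨D, hD, hfD⟩ := H.mem v f hv
  refine ⟨cls v, (H.mono v u f r hv hu hfp hvu).le, ?_, ⟨D, hD, f, hfD, hfi, hfp⟩, ?_⟩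
  · by_contra hc
    have := hcl _ D hD
    rw [if_neg hc] at this
    have := this.2.1 f hfD
    simp [hfi] at this
  · rintro j' D' hj hj' hpar hD' e he - hep
    obtain ⟨w, hw, rfl⟩ := H.surj j' D' e hD' he
    have hne : cls w ≠ cls u := by intro h; rw [h] at hpar; omega
    exact hbet w e hw hep (H.lt_of_cls_lt hv hw (hfp.trans hep.symm) hj)
      (H.lt_of_cls_lt hw hu hep (lt_of_le_of_ne hj' hne))

/-- A class map for the projection onto `X`, expressed with the positions of the whole
execution. -/
structure ObjClassMap (X : Obj) (G : List (GEv Proc Obj Op In Out))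
    (h : List (Finset (GEv Proc Obj Op In Out))) (T : ℕ → ℕ) : Prop where
  mem : ∀ u e, G[u]? = some e → e.obj = X → ∃ C, h[T u]? = some C ∧ e ∈ C
  surj : ∀ a C e, h[a]? = some C → e ∈ C → ∃ u, G[u]? = some e ∧ e.obj = X ∧ T u = a
  mono : ∀ u v e f, G[u]? = some e → G[v]? = some f → e.obj = X → f.obj = X →
    e.proc = f.proc → u < v → T u < T v
  rt : ∀ u v e f, G[u]? = some e → G[v]? = some f → e.obj = X → f.obj = X →
    e.isRes = true → f.isInv = true → u < v → T u < T v

theorem ClassMap.objClassMap {X : Obj} {G : List (GEv Proc Obj Op In Out)}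
    {h : List (Finset (GEv Proc Obj Op In Out))} {cls : ℕ → ℕ}
    (H : ClassMap (projObj G X) h cls) :
    ObjClassMap X G h (fun u => cls (cntBefore (fun e => decide (e.obj = X)) G u)) := by
  have at' : ∀ u e, G[u]? = some e → e.obj = X →
      (projObj G X)[cntBefore (fun e => decide (e.obj = X)) G u]? = some e :=
    fun u e he heX => filter_getElem?_cntBefore he (by simp [heX])
  have lt' : ∀ u v e, G[u]? = some e → e.obj = X → u < v →
      cntBefore (fun e => decide (e.obj = X)) G u < cntBefore (fun e => decide (e.obj = X)) G v :=
    fun u v e he heX huv => cntBefore_lt he (by simp [heX]) huv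
  refine ⟨fun u e he heX => H.mem _ e (at' u e he heX), ?_, ?_, ?_⟩
  · intro a C e hC he
    obtain ⟨k, hk, rfl⟩ := H.surj a C e hC he
    obtain ⟨u, rfl, hu, heX⟩ := exists_cntBefore_of_filter_getElem? hk
    exact ⟨u, hu, by simpa using heX, rfl⟩
  · intro u v e f he hf heX hfX hef huv
    exact H.mono _ _ e f (at' u e he heX) (at' v f hf hfX) hef (lt' u v e he heX huv)
  · intro u v e f he hf heX hfX her hfi huv
    exact H.rt _ _ e f (at' u e he heX) (at' v f hf hfX) her hfi (lt' u v e he heX huv)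

/-- Interval-sequential executions of the single objects that respect real time merge into one
of the whole system: blocks (an invoking class and the following responding class) are ordered
by the latest invocation of their object placed no later than the block. -/
theorem exists_merge {G : List (GEv Proc Obj Op In Out)} (hG : WF G)
    {hs : Obj → List (Finset (GEv Proc Obj Op In Out))} (hIS : ∀ X, IsISExec (hs X))
    {T : Obj → ℕ → ℕ} (H : ∀ X, ObjClassMap X G (hs X) (T X)) :
    ∃ h cls, ClassMap G h cls ∧ IsISExec h ∧ ∀ X, projObjIS h X = hs X := by
  classical
  have parity : ∀ u e, G[u]? = some e → (e.isInv = true ↔ T e.obj u % 2 = 0) := by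
    intro u e he
    obtain ⟨C, hC, heC⟩ := (H e.obj).mem u e he rfl
    exact (hIS _).isInv_iff hC heC
  let invs : Obj → ℕ → Finset ℕ := fun X i => (Finset.range G.length).filter
    (fun u => ∃ e, G[u]? = some e ∧ e.obj = X ∧ e.isInv = true ∧ T X u ≤ 2 * i)
  have mem_invs : ∀ X i u, u ∈ invs X i ↔
      ∃ e, G[u]? = some e ∧ e.obj = X ∧ e.isInv = true ∧ T X u ≤ 2 * i := by
    intro X i u
    simp only [invs, Finset.mem_filter, Finset.mem_range, and_iff_right_iff_imp]
    rintro ⟨e, he, -⟩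
    exact (List.getElem?_eq_some_iff.1 he).1
  let key : Obj → ℕ → ℕ := fun X i => (invs X i).sup id
  have key_mono : ∀ X i j, i ≤ j → key X i ≤ key X j := by
    intro X i j hij
    refine Finset.sup_mono fun u hu => ?_
    rw [mem_invs] at hu ⊢
    obtain ⟨e, h1, h2, h3, h4⟩ := hu
    exact ⟨e, h1, h2, h3, by omega⟩
  have le_key : ∀ v f, G[v]? = some f → f.isInv = true → v ≤ key f.obj (T f.obj v / 2) := by
    intro v f hf hfi
    have := (parity v f hf).1 hfi
    exact Finset.le_sup (f := id) ((mem_invs _ _ _).2 ⟨f, hf, rfl, hfi, by omega⟩)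
  have key_lt : ∀ u e, G[u]? = some e → e.isRes = true → key e.obj (T e.obj u / 2) < u := by
    intro u e he her
    have hei : ¬ e.isInv = true := by simpa using her
    have hodd := (parity u e he).not.1 hei
    obtain ⟨v, -, hvu, -⟩ := hG.exists_pred he her
    refine (Finset.sup_lt_iff (by simp; omega)).2 fun w hw => ?_
    obtain ⟨f, hf, hfX, hfi, hT⟩ := (mem_invs _ _ _).1 hw
    change w < u
    rcases lt_trichotomy w u with h | rfl | h
    · exact h
    · obtain rfl : e = f := by simpa [he] using hf
      exact absurd hfi hei
    · have := (H e.obj).rt u w e f he hf rfl hfX her hfi h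
      omega
  let S : Finset (Obj × ℕ) := (G.map GEv.obj).toFinset.biUnion fun X =>
    (Finset.range ((hs X).length / 2)).image fun i => (X, i)
  have exists_inv : ∀ x : Obj × ℕ, 2 * x.2 + 1 < (hs x.1).length →
      ∃ u e, G[u]? = some e ∧ e.obj = x.1 ∧ e.isInv = true ∧ T x.1 u = 2 * x.2 := by
    intro x hx
    have hC := List.getElem?_eq_getElem (l := hs x.1) (i := 2 * x.2) (by omega)
    obtain ⟨e, he⟩ := (hIS x.1).class_nonempty hC
    obtain ⟨u, hu, heX, hT⟩ := (H x.1).surj _ _ e hC he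
    exact ⟨u, e, hu, heX, ((hIS x.1).isInv_iff hC he).2 (by omega), hT⟩
  have mem_S : ∀ x, x ∈ S ↔ 2 * x.2 + 1 < (hs x.1).length := by
    intro x
    simp only [S, Finset.mem_biUnion, List.mem_toFinset, Finset.mem_image, Finset.mem_range]
    constructor
    · rintro ⟨X, -, i, hi, rfl⟩
      simp only
      omega
    · intro hx
      obtain ⟨u, e, hu, heX, -⟩ := exists_inv x hx
      refine ⟨x.1, ?_, x.2, by omega, rfl⟩
      exact List.mem_map.2 ⟨e, List.mem_iff_getElem?.2 ⟨u, hu⟩, heX⟩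
  have key_spec : ∀ x ∈ S, ∃ e, G[key x.1 x.2]? = some e ∧ e.obj = x.1 := by
    intro x hx
    obtain ⟨u, e, hu, heX, hei, hT⟩ := exists_inv x ((mem_S x).1 hx)
    obtain ⟨w, hw, hkey⟩ := Finset.exists_mem_eq_sup (invs x.1 x.2)
      ⟨u, (mem_invs _ _ _).2 ⟨e, hu, heX, hei, by omega⟩⟩ id
    obtain ⟨f, hf, hfX, -⟩ := (mem_invs _ _ _).1 hw
    exact ⟨f, by simpa [key, hkey] using hf, hfX⟩
  let K : Obj × ℕ → ℕ ×ₗ ℕ := fun x => toLex (key x.1 x.2, x.2)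
  have K_lt : ∀ x y, K x < K y ↔
      key x.1 x.2 < key y.1 y.2 ∨ key x.1 x.2 = key y.1 y.2 ∧ x.2 < y.2 := by
    intro x y
    simp [K, Prod.Lex.toLex_lt_toLex]
  have K_lt_same : ∀ X i j, i < j → K (X, i) < K (X, j) := by
    intro X i j hij
    rw [K_lt]
    rcases (key_mono X i j hij.le).lt_or_eq with h | h
    · exact Or.inl h
    · exact Or.inr ⟨h, hij⟩
  have K_inj : Set.InjOn K S := by
    intro x hx y hy hxy
    obtain ⟨e, he, hex⟩ := key_spec x hx
    obtain ⟨f, hf, hfy⟩ := key_spec y hy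
    have hxy' : key x.1 x.2 = key y.1 y.2 ∧ x.2 = y.2 := by
      simpa [K, Prod.ext_iff] using hxy
    rw [hxy'.1, hf] at he
    obtain rfl : f = e := by simpa using he
    exact Prod.ext (hex.symm.trans hfy) hxy'.2
  obtain ⟨L, hLS, hLK⟩ := S.exists_list_pairwise_lt K_inj
  have hLnd : L.Nodup := hLK.imp fun h => by rintro rfl; exact lt_irrefl _ h
  have mem_L : ∀ x, x ∈ L ↔ 2 * x.2 + 1 < (hs x.1).length := fun x => (hLS x).trans (mem_S x)
  let A : Obj × ℕ → Finset (GEv Proc Obj Op In Out) := fun x => (hs x.1).getD (2 * x.2) ∅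
  let B : Obj × ℕ → Finset (GEv Proc Obj Op In Out) := fun x => (hs x.1).getD (2 * x.2 + 1) ∅
  have hA : ∀ x ∈ L, (hs x.1)[2 * x.2]? = some (A x) := by
    intro x hx
    have : 2 * x.2 < (hs x.1).length := by have := (mem_L x).1 hx; omega
    simp [A, this]
  have hB : ∀ x ∈ L, (hs x.1)[2 * x.2 + 1]? = some (B x) := by
    intro x hx
    have : 2 * x.2 + 1 < (hs x.1).length := (mem_L x).1 hx
    simp [B, this]
  let h := L.flatMap fun x => [A x, B x]
  have cell_of_mem : ∀ x ∈ L, ∀ b < 2,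
      h[2 * L.idxOf x + b]? = (hs x.1)[2 * x.2 + b]? := by
    intro x hx b hb
    have hi : L[L.idxOf x]? = some x := by
      rw [List.getElem?_eq_getElem (List.idxOf_lt_length_iff.2 hx)]; simp
    interval_cases b
    · simp only [h, add_zero]
      rw [flatMap_pair_getElem?_even, hi, hA x hx]; rfl
    · simp only [h]
      rw [flatMap_pair_getElem?_odd, hi, hB x hx]; rfl
  have exists_cell : ∀ a C, h[a]? = some C →
      ∃ x ∈ L, 2 * L.idxOf x + a % 2 = a ∧ (hs x.1)[2 * x.2 + a % 2]? = some C := by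
    intro a C hC
    have hlt : a / 2 < L.length := by
      have := (List.getElem?_eq_some_iff.1 hC).1
      simp only [h, flatMap_pair_length] at this
      omega
    have hidx : L.idxOf L[a / 2] = a / 2 := hLnd.idxOf_getElem _ _
    have heq : 2 * L.idxOf L[a / 2] + a % 2 = a := by omega
    refine ⟨L[a / 2], List.getElem_mem _, heq, ?_⟩
    rw [← cell_of_mem _ (List.getElem_mem _) _ (Nat.mod_lt _ two_pos), heq, hC]
  let cls : ℕ → ℕ := fun u => (G[u]?).elim 0 fun e =>
    2 * L.idxOf (e.obj, T e.obj u / 2) + T e.obj u % 2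
  have cls_eq : ∀ u e, G[u]? = some e →
      cls u = 2 * L.idxOf (e.obj, T e.obj u / 2) + T e.obj u % 2 := by
    intro u e he
    simp [cls, he]
  have block_mem : ∀ u e, G[u]? = some e → (e.obj, T e.obj u / 2) ∈ L := by
    intro u e he
    obtain ⟨C, hC, -⟩ := (H e.obj).mem u e he rfl
    have := (List.getElem?_eq_some_iff.1 hC).1
    have := (hIS e.obj).1
    rw [mem_L]
    simp only
    omega
  have cls_lt : ∀ u v e f, G[u]? = some e → G[v]? = some f →
      K (e.obj, T e.obj u / 2) < K (f.obj, T f.obj v / 2) → cls u < cls v := by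
    intro u v e f he hf hK
    have := hLK.idxOf_lt (block_mem u e he) (block_mem v f hf) hK
    rw [cls_eq u e he, cls_eq v f hf]
    omega
  have mono_same : ∀ u v e f, G[u]? = some e → G[v]? = some f → e.proc = f.proc →
      e.obj = f.obj → u < v → cls u < cls v := by
    intro u v e f he hf hef hobj huv
    have hT := (H f.obj).mono u v e f he hf hobj rfl hef huv
    rcases (Nat.div_le_div_right (c := 2) hT.le).lt_or_eq with hlt | heq
    · exact cls_lt u v e f he hf (by rw [hobj]; exact K_lt_same _ _ _ hlt)
    · rw [cls_eq u e he, cls_eq v f hf, hobj, heq]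
      omega
  have rt : ∀ u v e f, G[u]? = some e → G[v]? = some f → e.isRes = true → f.isInv = true →
      u < v → cls u < cls v := by
    intro u v e f he hf her hfi huv
    refine cls_lt u v e f he hf ((K_lt _ _).2 (Or.inl ?_))
    exact (key_lt u e he her).trans (huv.trans_le (le_key v f hf hfi))
  have mono_res : ∀ u v e f, G[u]? = some e → G[v]? = some f → e.proc = f.proc →
      e.isRes = true → u < v → cls u < cls v := by
    intro u v e f he hf hef her huv
    by_cases hfi : f.isInv = true
    · exact rt u v e f he hf her hfi huv
    · obtain ⟨w, g, hwv, hg, hgi, hgp, hgo, hbet⟩ := hG.exists_pred hf (by simpa using hfi)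
      have huw : u < w := by
        rcases lt_trichotomy u w with h' | rfl | h'
        · exact h'
        · obtain rfl : e = g := by simpa [he] using hg
          simp [hgi] at her
        · exact (hbet u e he hef h' huv).elim
      exact (rt u w e g he hg her hgi huw).trans (mono_same w v g f hg hf hgp hgo hwv)
  have HC : ClassMap G h cls := by
    refine ⟨?_, ?_, ?_, rt⟩
    · intro u e he
      obtain ⟨C, hC, heC⟩ := (H e.obj).mem u e he rfl
      refine ⟨C, ?_, heC⟩
      rw [cls_eq u e he, cell_of_mem _ (block_mem u e he) _ (Nat.mod_lt _ two_pos)]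
      simpa only [Nat.div_add_mod] using hC
    · intro a C e hC he
      obtain ⟨x, -, hxa, hxC⟩ := exists_cell a C hC
      obtain ⟨u, hu, hex, hT⟩ := (H x.1).surj _ C e hxC he
      refine ⟨u, hu, ?_⟩
      have h1 : T x.1 u / 2 = x.2 := by omega
      have h2 : T x.1 u % 2 = a % 2 := by omega
      rw [cls_eq u e hu, hex, h1, h2]
      exact hxa
    · intro u v e f he hf hef huv
      by_cases hei : e.isInv = true
      · obtain ⟨w, g, huw, hwv, hg, hgr, hgp, hgo⟩ := hG.exists_succ he hei hf hef.symm huv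
        have hlt := mono_same u w e g he hg hgp.symm hgo.symm huw
        rcases hwv.lt_or_eq with h' | rfl
        · exact hlt.trans (mono_res w v g f hg hf (hgp.trans hef) hgr h')
        · exact hlt
      · exact mono_res u v e f he hf hef (by simpa using hei) huv
  refine ⟨h, cls, HC, HC.isISExec hG ?_ ?_, ?_⟩
  · simp only [h, flatMap_pair_length]
    omega
  · intro a C hC
    obtain ⟨x, -, -, hxC⟩ := exists_cell a C hC
    have := (hIS x.1).2.1 _ C hxC
    rwa [Nat.mul_add_mod, Nat.mod_mod] at this
  · intro X
    have on_obj : ∀ (Y : Obj) (a : ℕ) (C : Finset (GEv Proc Obj Op In Out)),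
        (hs Y)[a]? = some C → C.Nonempty ∧ ∀ e ∈ C, e.obj = Y := by
      intro Y a C hC
      refine ⟨(hIS Y).class_nonempty hC, fun e he => ?_⟩
      obtain ⟨-, -, heY, -⟩ := (H Y).surj a C e hC he
      exact heY
    have hfilter : L.filter (fun x => decide (x.1 = X)) =
        (List.range ((hs X).length / 2)).map fun i => (X, i) := by
      have p1 : (L.filter (fun x => decide (x.1 = X))).Pairwise (fun x y => K x < K y) :=
        hLK.filter _
      have p2 : ((List.range ((hs X).length / 2)).map fun i => (X, i)).Pairwise
          (fun x y => K x < K y) :=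
        List.pairwise_map.2 (List.pairwise_lt_range.imp fun {i j} hij => K_lt_same X i j hij)
      refine List.Perm.eq_of_pairwise (le := fun x y => K x < K y)
        (fun x y _ _ hxy hyx => absurd hxy hyx.not_gt) p1 p2 ?_
      refine (List.perm_ext_iff_of_nodup (p1.imp fun h => by rintro rfl; exact lt_irrefl _ h)
        (p2.imp fun h => by rintro rfl; exact lt_irrefl _ h)).2 fun x => ?_
      simp only [List.mem_filter, mem_L, decide_eq_true_eq, List.mem_map, List.mem_range]
      constructor
      · rintro ⟨hx, rfl⟩
        exact ⟨x.2, by omega, rfl⟩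
      · rintro ⟨i, hi, rfl⟩
        exact ⟨by simp only; omega, rfl⟩
    rw [projObjIS_flatMap_pair (fun x hx => on_obj _ _ _ (hA x hx))
      (fun x hx => on_obj _ _ _ (hB x hx)), hfilter, List.flatMap_map]
    exact flatMap_range_getD_pair (hIS X).1 ∅

end Merging

section Extensions

theorem filter_flatMap_fiber {α β : Type*} [DecidableEq β] (k : α → β) (F : β → List α)
    (hF : ∀ b, ∀ a ∈ F b, k a = b) {L : List β} (hL : L.Nodup) (b : β) :
    (L.flatMap F).filter (fun a => decide (k a = b)) = if b ∈ L then F b else [] := by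
  induction L with
  | nil => simp
  | cons c L ih =>
    obtain ⟨hc, hL⟩ := List.nodup_cons.1 hL
    rw [List.flatMap_cons, List.filter_append, ih hL]
    by_cases hcb : c = b
    · subst hcb
      have : (F c).filter (fun a => decide (k a = c)) = F c :=
        List.filter_eq_self.2 fun a ha => by simpa using hF c a ha
      simp [this, hc]
    · have : (F c).filter (fun a => decide (k a = b)) = [] :=
        List.filter_eq_nil_iff.2 fun a ha => by simpa [hF c a ha] using hcb
      simp [this, Ne.symm hcb]

/-- A response appended to the projection onto `X` answers the last event of its process,
an invocation on `X`. -/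
theorem WF.response_of_append_projObj {E F : List (GEv Proc Obj Op In Out)} {X : Obj}
    (hE : WF E) (hF : WF (projObj E X ++ F)) (hres : ∀ e ∈ F, e.isRes = true)
    {r : GEv Proc Obj Op In Out} (hr : r ∈ F) :
    ∃ l p o x p' y, projP E r.proc = l ++ [.inv p X o x] ∧ projP F r.proc = [.res p' X o y] ∧
      r = .res p' X o y := by
  have hp := hF r.proc
  have happ : projP (projObj E X ++ F) r.proc = projP (projObj E X) r.proc ++ projP F r.proc := by
    simp [projP]
  have hrF : r ∈ projP F r.proc := by simp [projP, hr]
  rw [happ] at hp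
  rcases hp.eq_of_append_responses fun e he => hres e (List.mem_of_mem_filter he) with
    h | ⟨l, p, p', Y, o, x, y, h1, h2⟩
  · simp [h] at hrF
  · have hY : Y = X := by
      have : GEv.inv p Y o x ∈ projP (projObj E X) r.proc := by simp [h1]
      exact of_decide_eq_true (List.mem_filter.1 (List.mem_of_mem_filter this)).2
    subst hY
    rw [projP_projObj] at h1
    have hlast := (hE r.proc).getLast?_of_filter_obj (X := Y) (e := .inv p Y o x)
      (by simp [h1]) rfl
    obtain ⟨l', hl'⟩ := List.getLast?_eq_some_iff.1 hlast
    exact ⟨l', p, o, x, p', y, hl', h2, by simpa [h2] using hrF⟩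

theorem WF.exists_common_extension {E : List (GEv Proc Obj Op In Out)} (hE : WF E)
    {F : Obj → List (GEv Proc Obj Op In Out)} (hF : ∀ X, WF (projObj E X ++ F X))
    (hres : ∀ X, ∀ e ∈ F X, e.isRes = true) :
    ∃ Ebar, Extension E Ebar ∧ ∀ X, projObj Ebar X = projObj E X ++ F X := by
  have answer := fun X r (hr : r ∈ F X) => hE.response_of_append_projObj (hF X) (hres X) hr
  have hobj : ∀ X, ∀ e ∈ F X, e.obj = X := by
    intro X e he
    obtain ⟨-, -, -, -, -, -, -, -, rfl⟩ := answer X e he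
    rfl
  set L := (E.map GEv.obj).dedup
  set F' := L.flatMap F
  have hproj : ∀ X, projObj F' X = F X := by
    intro X
    refine (filter_flatMap_fiber GEv.obj F hobj (List.nodup_dedup _) X).trans ?_
    split_ifs with hX
    · rfl
    · symm
      refine List.eq_nil_iff_forall_not_mem.2 fun r hr => hX ?_
      obtain ⟨l, p, o, x, -, -, hl, -⟩ := answer X r hr
      have : GEv.inv p X o x ∈ projP E r.proc := by simp [hl]
      exact List.mem_dedup.2 (List.mem_map.2 ⟨_, List.mem_of_mem_filter this, rfl⟩)
  refine ⟨E ++ F', ⟨fun p => ?_, F', rfl, ?_⟩, fun X => ?_⟩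
  · have happ : projP (E ++ F') p = projP E p ++ projP F' p := by simp [projP]
    rw [happ]
    rcases hnil : projP F' p with _ | ⟨r, t⟩
    · simpa using hE p
    · have hr : r ∈ projP F' p := by simp [hnil]
      obtain ⟨hrF', hrp⟩ : r ∈ F' ∧ r.proc = p := by simpa [projP] using hr
      subst hrp
      obtain ⟨X, -, hrX⟩ := List.mem_flatMap.1 hrF'
      obtain ⟨l, q, o, x, q', y, hl, hFX, -⟩ := answer X r hrX
      have hall : (projP F' r.proc).filter (fun e => decide (e.obj = X)) = projP F' r.proc := by
        refine List.filter_eq_self.2 fun s hs => ?_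
        obtain ⟨hsF', hsp⟩ : s ∈ F' ∧ s.proc = r.proc := by simpa [projP] using hs
        obtain ⟨Y, -, hsY⟩ := List.mem_flatMap.1 hsF'
        obtain ⟨l₂, q₂, o₂, x₂, -, -, hl₂, -⟩ := answer Y s hsY
        rw [hsp, hl] at hl₂
        have := (List.append_inj' hl₂ rfl).2
        simp only [List.cons.injEq, GEv.inv.injEq, and_true] at this
        simp [hobj Y s hsY, this.2.1]
      rw [← hnil, ← hall, ← projP_projObj, hproj, hFX, hl]
      have := hE r.proc
      rw [hl] at this
      exact this.append_response
  · intro e he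
    obtain ⟨X, -, heX⟩ := List.mem_flatMap.1 he
    exact hres X e heX
  · rw [← hproj X]
    simp [projObj]

end Extensions

/-! ## Statement: locality of interval-linearizability -/

/-- **Locality of interval-linearizability.** A well-formed execution `E` is
interval-linearizable (with respect to the system of objects `spec`) if and only if,
for every object `X`, the projection `E|_X` is interval-linearizable with respect to
`X` alone. -/
theorem interval_linearizability_is_local
    (spec : Obj → GISObject Proc Obj Op In Out)
    (E : List (GEv Proc Obj Op In Out)) (hwf : WF E) :
    GIntervalLin spec E ↔ ∀ X : Obj, GIntervalLinOn (spec X) (projObj E X) := by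
  constructor
  · rintro ⟨Ebar, h, ⟨hwfbar, F, rfl, hF⟩, hIS, hproj, hspec, hresp⟩ X
    obtain ⟨cls, H⟩ := exists_classMap hwfbar.comp hIS.uniqPerProc hproj hresp
    obtain ⟨cls', H'⟩ := H.exists_projObj X
    rw [projObj_comp hwfbar] at H'
    have hwfX := hwfbar.projObj X
    refine ⟨projObj (E ++ F) X, projObjIS h X, ⟨hwfX, projObj F X, by simp [projObj], ?_⟩,
      hspec X, H'.projP_eq, H'.respects hwfX.comp⟩
    exact fun e he => hF e (List.mem_of_mem_filter he)
  · intro hloc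
    choose Ebars hs hext hspec hproj hresp using hloc
    choose hwfs Fs hEbars hFs using hext
    obtain rfl : Ebars = fun X => projObj E X ++ Fs X := funext hEbars
    obtain ⟨Ebar, hextE, hEbar⟩ := hwf.exists_common_extension hwfs hFs
    have hcomp : ∀ X, comp (projObj E X ++ Fs X) = projObj (comp Ebar) X := fun X => by
      rw [projObj_comp hextE.1, hEbar]
    have hcls := fun X => exists_classMap (hwfs X).comp (hspec X).1.uniqPerProc (hproj X) (hresp X)
    simp only [hcomp] at hcls
    choose cls hcls using hcls
    obtain ⟨h, c, H, hIS, hh⟩ := exists_merge hextE.1.comp (fun X => (hspec X).1)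
      (fun X => (hcls X).objClassMap)
    exact ⟨Ebar, h, hextE, hIS, H.projP_eq, fun X => by rw [hh]; exact hspec X,
      H.respects hextE.1.comp⟩
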